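/- Let G = (V,E,ℓ) be a weighted k-path separable graph with n vertices whose weighted diameter is at most D (every two vertices are at distance at most D). Then there exists a collection B = {P₁, …, P_κ} of κ ≤ k simple paths in G, each of total length at most 32D, such that for every vertex v of G not lying on any of these paths, the closed ball of radius 4D around v in the graph obtained from G by deleting all vertices of the paths in B contains at most (3/4)·n vertices. -/

import Mathlib

open SimpleGraph

section Defs

variable {V : Type} [Fintype V] [DecidableEq V]

/-- Total length of a walk with respect to edge lengths `ℓ`. -/
def wlen {G : SimpleGraph V} (ℓ : Sym2 V → ℝ) {u v : V} (p : G.Walk u v) : ℝ :=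
  (p.edges.map ℓ).sum

/-- All vertices of the walk lie in the vertex set `A`. -/
def WalkIn {G : SimpleGraph V} (A : Set V) {u v : V} (p : G.Walk u v) : Prop :=
  ∀ x ∈ p.support, x ∈ A

/-- The distance between `u` and `v` within the induced subgraph on `A`
is at most `r`: there is a walk of total length at most `r` that stays in `A`. -/
def DistLE (G : SimpleGraph V) (ℓ : Sym2 V → ℝ) (A : Set V) (u v : V) (r : ℝ) : Prop :=
  ∃ p : G.Walk u v, WalkIn A p ∧ wlen ℓ p ≤ r

/-- Edge lengths are positive on all edges. -/
def PosWeights (G : SimpleGraph V) (ℓ : Sym2 V → ℝ) : Prop :=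
  ∀ e ∈ G.edgeSet, 0 < ℓ e

/-- A (simple) path in `G`, bundled with its endpoints. -/
structure PathIn (G : SimpleGraph V) where
  src : V
  dst : V
  walk : G.Walk src dst
  isPath : walk.IsPath

/-- The set of vertices lying on some path of the list `L`. -/
def pathSupp {G : SimpleGraph V} (L : List (PathIn G)) : Set V :=
  {x | ∃ p ∈ L, x ∈ p.walk.support}

/-- The set of vertices lying on some path of some group in `L`. -/
def suppL {G : SimpleGraph V} (L : List (List (PathIn G))) : Set V :=
  {x | ∃ ps ∈ L, ∃ p ∈ ps, x ∈ p.walk.support}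

/-- `p` is a shortest path of the subgraph induced on `A`. -/
def IsShortestPathIn (G : SimpleGraph V) (ℓ : Sym2 V → ℝ) (A : Set V) (p : PathIn G) : Prop :=
  WalkIn A p.walk ∧ ∀ q : G.Walk p.src p.dst, WalkIn A q → wlen ℓ p.walk ≤ wlen ℓ q

/-- The induced subgraph of `G` on the vertex set `A` is `k`-path separable:
there is a sequence of groups of paths, each path being a shortest path of the
graph obtained by deleting the vertices of all previous groups, with at most `k`
paths in total, such that after deleting all these paths every connected component
has at most half as many vertices, and the remaining graph is empty or itself
`k`-path separable. -/
inductive KPathSep (G : SimpleGraph V) (ℓ : Sym2 V → ℝ) (k : ℕ) : Set V → Prop where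
  | step : ∀ (A : Set V) (L : List (List (PathIn G))),
      (L.map List.length).sum ≤ k →
      (∀ i : Fin L.length, ∀ p ∈ L.get i,
        IsShortestPathIn G ℓ (A \ suppL (L.take i)) p) →
      (∀ v ∈ A \ suppL L,
        2 * Set.ncard {w | w ∈ A \ suppL L ∧ ∃ q : G.Walk v w, WalkIn (A \ suppL L) q}
          ≤ Set.ncard A) →
      (A \ suppL L ≠ ∅ → KPathSep G ℓ k (A \ suppL L)) →
      KPathSep G ℓ k A

/-- `G` is universally `k`-path separable: it is `k`-path separable
for every positive edge-length function. -/
def UnivKPathSeparable (G : SimpleGraph V) (k : ℕ) : Prop :=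
  ∀ ℓ : Sym2 V → ℝ, PosWeights G ℓ → KPathSep G ℓ k Set.univ

end Defs

/-- The vertices reachable from `v` inside `U` by a walk of length at most `r`. -/
def ballIn {V : Type} (G : SimpleGraph V) (ℓ : Sym2 V → ℝ)
    (U : Set V) (v : V) (r : ℝ) : Set V :=
  {u | DistLE G ℓ U v u r}

section Lemmas

variable {V : Type} {G : SimpleGraph V} {ℓ : Sym2 V → ℝ}

theorem wlen_append {u v w : V} (p : G.Walk u v) (q : G.Walk v w) :
    wlen ℓ (p.append q) = wlen ℓ p + wlen ℓ q := by
  simp [wlen]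

theorem wlen_reverse {u v : V} (p : G.Walk u v) : wlen ℓ p.reverse = wlen ℓ p := by
  simp [wlen, List.sum_reverse]

theorem wlen_nonneg (hpos : PosWeights G ℓ) {u v : V} (p : G.Walk u v) : 0 ≤ wlen ℓ p := by
  refine List.sum_nonneg fun x hx => ?_
  obtain ⟨e, he, rfl⟩ := List.mem_map.1 hx
  exact (hpos e (p.edges_subset_edgeSet he)).le

theorem walkIn_append {A : Set V} {u v w : V} {p : G.Walk u v} {q : G.Walk v w} :
    WalkIn A (p.append q) ↔ WalkIn A p ∧ WalkIn A q := by
  simp only [WalkIn, Walk.mem_support_append_iff]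
  grind

theorem walkIn_reverse {A : Set V} {u v : V} {p : G.Walk u v} :
    WalkIn A p.reverse ↔ WalkIn A p := by
  simp [WalkIn]

theorem DistLE.symm {A : Set V} {u v : V} {r : ℝ} (h : DistLE G ℓ A u v r) :
    DistLE G ℓ A v u r := by
  obtain ⟨p, hp, hl⟩ := h
  exact ⟨p.reverse, walkIn_reverse.2 hp, (wlen_reverse p).trans_le hl⟩

theorem DistLE.trans {A : Set V} {u v w : V} {r s : ℝ} (h : DistLE G ℓ A u v r)
    (h' : DistLE G ℓ A v w s) : DistLE G ℓ A u w (r + s) := by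
  obtain ⟨p, hp, hl⟩ := h
  obtain ⟨q, hq, hl'⟩ := h'
  exact ⟨p.append q, walkIn_append.2 ⟨hp, hq⟩, (wlen_append p q).trans_le (add_le_add hl hl')⟩

/-- A walk witnessing membership in a ball stays inside that ball. -/
theorem walkIn_ballIn (hpos : PosWeights G ℓ) {U : Set V} {v u : V} {r : ℝ} {p : G.Walk v u}
    (hp : WalkIn U p) (hl : wlen ℓ p ≤ r) : WalkIn (ballIn G ℓ U v r) p := by
  intro x hx
  obtain ⟨q, s, rfl⟩ := Walk.mem_support_iff_exists_append.1 hx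
  refine ⟨q, (walkIn_append.1 hp).1, ?_⟩
  rw [wlen_append] at hl
  linarith [wlen_nonneg hpos s]

/-- If a ball computed in `U` lies in `A`, then it is contained in the ball computed in `A`. -/
theorem ballIn_subset_ballIn (hpos : PosWeights G ℓ) {U A : Set V} {v : V} {r : ℝ}
    (h : ballIn G ℓ U v r ⊆ A) : ballIn G ℓ U v r ⊆ ballIn G ℓ A v r := by
  rintro u ⟨p, hp, hl⟩
  exact ⟨p, fun x hx => h (walkIn_ballIn hpos hp hl x hx), hl⟩

theorem ballIn_subset (U : Set V) (v : V) (r : ℝ) : ballIn G ℓ U v r ⊆ U := by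
  rintro u ⟨p, hp, -⟩
  exact hp u p.end_mem_support

/-- Cut off the part of a walk before its first vertex in `N`. -/
theorem exists_append_first_mem (N : Set V) {u v : V} (p : G.Walk u v)
    (h : ∃ x ∈ p.support, x ∈ N) :
    ∃ (a : V) (r : G.Walk u a) (q : G.Walk a v), p = r.append q ∧ a ∈ N ∧
      ∀ x ∈ p.support, x ∈ N → x ∈ q.support := by
  induction p with
  | nil =>
    obtain ⟨x, hx, hN⟩ := h
    obtain rfl : x = _ := by simpa using hx
    exact ⟨_, Walk.nil, Walk.nil, rfl, hN, fun _ hy _ => hy⟩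
  | @cons u w v e p ih =>
    by_cases hu : u ∈ N
    · exact ⟨u, Walk.nil, Walk.cons e p, rfl, hu, fun _ hy _ => hy⟩
    · have hne : ∀ x ∈ (Walk.cons e p).support, x ∈ N → x ∈ p.support := by
        intro x hx hN
        rcases List.mem_cons.1 (by simpa using hx) with rfl | hx
        · exact absurd hN hu
        · exact hx
      obtain ⟨x, hx, hN⟩ := h
      obtain ⟨a, r, q, rfl, ha, hq⟩ := ih ⟨x, hne x hx hN, hN⟩
      exact ⟨a, Walk.cons e r, q, rfl, ha, fun y hy hyN => hq y (hne y hy hyN) hyN⟩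

/-- The part of a walk between its first and last vertices in `N`. -/
theorem exists_append_mem_mem (N : Set V) {u v : V} (p : G.Walk u v)
    (h : ∃ x ∈ p.support, x ∈ N) :
    ∃ (a b : V) (r : G.Walk u a) (q : G.Walk a b) (s : G.Walk b v),
      p = r.append (q.append s) ∧ a ∈ N ∧ b ∈ N ∧
      ∀ x ∈ p.support, x ∈ N → x ∈ q.support := by
  obtain ⟨a, r, q, rfl, ha, hq⟩ := exists_append_first_mem N p h
  obtain ⟨b, s, t, hst, hb, ht⟩ := exists_append_first_mem N q.reverse ⟨a, by simp, ha⟩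
  refine ⟨a, b, r, t.reverse, s.reverse, ?_, ha, hb, fun x hx hN => ?_⟩
  · rw [← Walk.reverse_append, ← hst, Walk.reverse_reverse]
  · simpa using ht x (by simpa using hq x hx hN) hN

/-- The vertices of a shortest path of `A` within distance `r` of `c` are covered by at most one
path of length at most `2 * r`. -/
theorem IsShortestPathIn.exists_cover_ballIn {A : Set V} {p : PathIn G}
    (hp : IsShortestPathIn G ℓ A p) (c : V) (r : ℝ) :
    ∃ l : List (PathIn G), l.length ≤ 1 ∧ (∀ q ∈ l, wlen ℓ q.walk ≤ 2 * r) ∧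
      ∀ x ∈ p.walk.support, x ∈ ballIn G ℓ A c r → x ∈ pathSupp l := by
  by_cases h : ∃ x ∈ p.walk.support, x ∈ ballIn G ℓ A c r
  · obtain ⟨src, dst, w, hw⟩ := p
    obtain ⟨hin, hmin⟩ := hp
    obtain ⟨a, b, r₁, q, s, rfl, ha, hb, hq⟩ := exists_append_mem_mem _ w h
    refine ⟨[⟨a, b, q, hw.of_append_right.of_append_left⟩], le_rfl, ?_,
      fun x hx hN => ⟨_, List.mem_singleton_self _, hq x hx hN⟩⟩
    obtain ⟨t, ht, htl⟩ := (DistLE.symm ha).trans hb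
    have hin' := walkIn_append.1 hin
    have := hmin (r₁.append (t.append s))
      (walkIn_append.2 ⟨hin'.1, walkIn_append.2 ⟨ht, (walkIn_append.1 hin'.2).2⟩⟩)
    simp only [wlen_append] at this
    simp only [List.mem_singleton, forall_eq]
    linarith
  · exact ⟨[], by simp, by simp, fun x hx hN => absurd ⟨x, hx, hN⟩ h⟩

theorem mem_pathSupp_append {B C : List (PathIn G)} {x : V} :
    x ∈ pathSupp (B ++ C) ↔ x ∈ pathSupp B ∨ x ∈ pathSupp C := by
  simp only [pathSupp, Set.mem_ofPred_eq, List.mem_append]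
  grind

theorem mem_suppL_cons {ps : List (PathIn G)} {L : List (List (PathIn G))} {x : V} :
    x ∈ suppL (ps :: L) ↔ x ∈ pathSupp ps ∨ x ∈ suppL L := by
  simp [suppL, pathSupp]

theorem diff_suppL_cons (A : Set V) (ps : List (PathIn G)) (L : List (List (PathIn G))) :
    A \ suppL (ps :: L) = (A \ pathSupp ps) \ suppL L := by
  ext x
  simp only [Set.mem_sdiff, mem_suppL_cons]
  tauto

/-- The parts of shortest paths of `A` within distance `r` of `c` are covered by at most as many
paths of length at most `2 * r`. -/
theorem exists_cover_pathSupp_inter_ballIn {A : Set V} (c : V) (r : ℝ) (ps : List (PathIn G))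
    (hps : ∀ p ∈ ps, IsShortestPathIn G ℓ A p) :
    ∃ B : List (PathIn G), B.length ≤ ps.length ∧ (∀ q ∈ B, wlen ℓ q.walk ≤ 2 * r) ∧
      pathSupp ps ∩ ballIn G ℓ A c r ⊆ pathSupp B := by
  induction ps with
  | nil => exact ⟨[], le_rfl, by simp, by simp [pathSupp]⟩
  | cons p ps ih =>
    obtain ⟨B, hB, hBl, hBc⟩ := ih fun q hq => hps q (List.mem_cons_of_mem _ hq)
    obtain ⟨l, hl, hll, hlc⟩ := (hps p List.mem_cons_self).exists_cover_ballIn c r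
    refine ⟨l ++ B, by simp; omega, fun q hq => ?_, ?_⟩
    · exact (List.mem_append.1 hq).elim (hll q) (hBl q)
    · rintro x ⟨⟨q, hq, hx⟩, hxc⟩
      rw [mem_pathSupp_append]
      rcases List.mem_cons.1 hq with rfl | hq
      · exact Or.inl (hlc x hx hxc)
      · exact Or.inr (hBc ⟨⟨q, hq, hx⟩, hxc⟩)

/-- Two vertex sets, each containing more than half of the vertices, intersect. -/
theorem inter_nonempty_of_card_lt [Fintype V] {X Y : Set V} (hX : Fintype.card V < 2 * X.ncard)
    (hY : Fintype.card V < 2 * Y.ncard) : (X ∩ Y).Nonempty := by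
  rw [← Set.not_disjoint_iff_nonempty_inter]
  intro h
  have h₁ := Set.ncard_union_eq h
  have h₂ := Set.ncard_le_card (X ∪ Y)
  rw [Nat.card_eq_fintype_card] at h₂
  omega

/-- A group of shortest paths of `A` can be replaced by short paths such that every large ball
in `A` avoiding the short paths avoids the whole group. -/
theorem exists_short_paths_of_group [Fintype V] (hpos : PosWeights G ℓ) {A : Set V} (r : ℝ)
    (ps : List (PathIn G)) (hps : ∀ p ∈ ps, IsShortestPathIn G ℓ A p) :
    ∃ B : List (PathIn G), B.length ≤ ps.length ∧ (∀ q ∈ B, wlen ℓ q.walk ≤ 6 * r) ∧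
      ∀ (U : Set V) (v : V), Disjoint U (pathSupp B) →
        Fintype.card V < 2 * (ballIn G ℓ U v r).ncard → ballIn G ℓ U v r ⊆ A →
        ballIn G ℓ U v r ⊆ A \ pathSupp ps := by
  by_cases h : ∃ c, Fintype.card V < 2 * (ballIn G ℓ A c r).ncard
  · obtain ⟨c, hc⟩ := h
    obtain ⟨B, hB, hBl, hBc⟩ := exists_cover_pathSupp_inter_ballIn c (r + r + r) ps hps
    refine ⟨B, hB, fun q hq => (hBl q hq).trans (by linarith), fun U v hU hv hA u hu => ?_⟩
    refine ⟨hA hu, fun hups => ?_⟩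
    have hsub := ballIn_subset_ballIn hpos hA
    obtain ⟨w, hwc, hwv⟩ := inter_nonempty_of_card_lt hc hv
    have hcu : DistLE G ℓ A c u (r + r + r) := (hwc.trans (hsub hwv).symm).trans (hsub hu)
    exact Set.disjoint_left.1 hU (ballIn_subset U v r hu) (hBc ⟨hups, hcu⟩)
  · push Not at h
    refine ⟨[], by simp, by simp, fun U v _ hv hA => absurd hv (not_lt.2 ?_)⟩
    have := Set.ncard_le_ncard (ballIn_subset_ballIn hpos hA)
    have := h v
    omega

/-- A sequence of groups of shortest paths can be replaced by short paths such that every large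
ball in `A` avoiding the short paths avoids all the groups. -/
theorem exists_short_paths_of_groups [Fintype V] (hpos : PosWeights G ℓ) (r : ℝ)
    (L : List (List (PathIn G))) (A : Set V)
    (hL : ∀ i : Fin L.length, ∀ p ∈ L.get i, IsShortestPathIn G ℓ (A \ suppL (L.take i)) p) :
    ∃ B : List (PathIn G), B.length ≤ (L.map List.length).sum ∧
      (∀ q ∈ B, wlen ℓ q.walk ≤ 6 * r) ∧
      ∀ (U : Set V) (v : V), Disjoint U (pathSupp B) →
        Fintype.card V < 2 * (ballIn G ℓ U v r).ncard → ballIn G ℓ U v r ⊆ A →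
        ballIn G ℓ U v r ⊆ A \ suppL L := by
  induction L generalizing A with
  | nil => exact ⟨[], by simp, by simp, fun U v _ _ hA => by simpa [suppL] using hA⟩
  | cons ps L ih =>
    obtain ⟨B, hB, hBl, hBc⟩ := exists_short_paths_of_group hpos (A := A) r ps fun p hp => by
      simpa [suppL] using hL ⟨0, by simp⟩ p hp
    obtain ⟨C, hC, hCl, hCc⟩ := ih (A \ pathSupp ps) fun i p hp => by
      simpa [diff_suppL_cons] using hL i.succ p hp
    refine ⟨B ++ C, by simp; omega, fun q hq => ?_, fun U v hU hv hA => ?_⟩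
    · exact (List.mem_append.1 hq).elim (hBl q) (hCl q)
    · have hUB : Disjoint U (pathSupp B) :=
        hU.mono_right fun x hx => mem_pathSupp_append.2 (Or.inl hx)
      have hUC : Disjoint U (pathSupp C) :=
        hU.mono_right fun x hx => mem_pathSupp_append.2 (Or.inr hx)
      rw [diff_suppL_cons]
      exact hCc U v hUC hv (hBc U v hUB hv hA)

end Lemmas

/-- **Bounded-length boundary for k-path separable graphs.** Let `G = (V,E,ℓ)`
be a weighted `k`-path separable graph with `n` vertices whose weighted
diameter is at most `D`. Then there is a collection of at most `k` simple
paths in `G`, each of total length at most `32D`, such that for every vertex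
`v` not lying on any of these paths, the closed ball of radius `4D` around `v`
in the graph obtained by deleting all vertices of these paths contains at most
`(3/4)·n` vertices. -/
theorem boundary_paths_exist {V : Type} [Fintype V] [DecidableEq V]
    (G : SimpleGraph V) (ℓ : Sym2 V → ℝ) (k : ℕ) (D : ℝ)
    (hpos : PosWeights G ℓ)
    (hsep : KPathSep G ℓ k Set.univ)
    (hdiam : ∀ u v : V, DistLE G ℓ Set.univ u v D) :
    ∃ B : List (PathIn G),
      B.length ≤ k ∧
      (∀ p ∈ B, wlen ℓ p.walk ≤ 32 * D) ∧
      (∀ v : V, v ∉ pathSupp B →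
        (Set.ncard {u : V | DistLE G ℓ (Set.univ \ pathSupp B) v u (4 * D)} : ℝ) ≤
          3 / 4 * (Fintype.card V : ℝ)) := by
  obtain ⟨-, L, hk, hL, hhalf, -⟩ := hsep
  obtain ⟨B, hB, hBl, hBc⟩ := exists_short_paths_of_groups hpos (4 * D) L Set.univ hL
  refine ⟨B, hB.trans hk, fun p hp => ?_, fun v hv => ?_⟩
  · obtain ⟨q, -, hq⟩ := hdiam p.src p.src
    linarith [hBl p hp, wlen_nonneg hpos q]
  · change ((ballIn G ℓ (Set.univ \ pathSupp B) v (4 * D)).ncard : ℝ) ≤ _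
    set X := ballIn G ℓ (Set.univ \ pathSupp B) v (4 * D)
    have hle : 2 * X.ncard ≤ Fintype.card V := by
      by_contra! hlt
      have hsub := hBc _ v Set.disjoint_sdiff_left hlt (Set.subset_univ _)
      have hvX : v ∈ X := by
        obtain ⟨u, p, hp, hl⟩ := Set.nonempty_of_ncard_ne_zero (s := X) (by omega)
        exact walkIn_ballIn hpos hp hl v p.start_mem_support
      have hcomp := hhalf v (hsub hvX)
      rw [Set.ncard_univ, Nat.card_eq_fintype_card] at hcomp
      refine absurd hlt (not_lt.2 (le_trans ?_ hcomp))
      refine Nat.mul_le_mul_left 2 (Set.ncard_le_ncard fun u hu => ?_)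
      obtain ⟨p, hp, hl⟩ := hu
      exact ⟨hsub ⟨p, hp, hl⟩, p, fun x hx => hsub (walkIn_ballIn hpos hp hl x hx)⟩
    have : (2 : ℝ) * X.ncard ≤ Fintype.card V := by exact_mod_cast hle
    linarith [(Nat.cast_nonneg X.ncard : (0 : ℝ) ≤ X.ncard)]
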